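/- Let μ₀ and μ be Borel probability measures on ℝ with finite second moments, and set μ_θ = (1−θ)μ₀ + θμ for θ ∈ (0,1]. Then lim_{θ→0⁺} (1/θ) ∫_ℝ p_Y(y;μ_θ) log( p_Y(y;μ_θ) / p_Y(y;μ₀) ) dy = 0; that is, the Kullback–Leibler divergence between the output densities p_Y(·;μ_θ) and p_Y(·;μ₀) is o(θ) as θ → 0⁺. -/

import Mathlib

open MeasureTheory Real Filter

/-- The standard Gaussian density `φ(t) = (2π)^{-1/2} e^{-t²/2}`. -/
noncomputable def gauss (t : ℝ) : ℝ := Real.exp (-t ^ 2 / 2) / Real.sqrt (2 * Real.pi)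

/-- The output density `p_Y(y;μ) = ∫ φ(y−x) dμ(x)`. -/
noncomputable def outDen (μ : Measure ℝ) (y : ℝ) : ℝ := ∫ x, gauss (y - x) ∂μ

lemma gauss_pos (t : ℝ) : 0 < gauss t := by unfold gauss; positivity

lemma gauss_cont : Continuous gauss := by unfold gauss; fun_prop

lemma gauss_le_one (t : ℝ) : gauss t ≤ 1 := by
  unfold gauss
  have h1 : Real.exp (-t ^ 2 / 2) ≤ 1 := Real.exp_le_one_iff.2 (by nlinarith [sq_nonneg t])
  have h2 : 1 ≤ Real.sqrt (2 * Real.pi) := by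
    rw [Real.one_le_sqrt]; linarith [Real.pi_gt_three]
  rw [div_le_one (by positivity)]
  linarith

lemma gauss_int : Integrable gauss := by
  have h := (integrable_exp_neg_mul_sq (b := 1 / 2) (by norm_num)).div_const (Real.sqrt (2 * Real.pi))
  refine h.congr (ae_of_all _ fun x => ?_)
  unfold gauss
  ring_nf

lemma gauss_sq_int : Integrable fun t => t ^ 2 * gauss t := by
  have h := (integrable_rpow_mul_exp_neg_mul_sq (b := 1 / 2) (by norm_num)
    (s := 2) (by norm_num)).div_const (Real.sqrt (2 * Real.pi))
  refine h.congr (ae_of_all _ fun x => ?_)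
  unfold gauss
  simp only [Real.rpow_two]
  ring_nf

lemma gauss_shift_int (μ : Measure ℝ) [IsFiniteMeasure μ] (y : ℝ) :
    Integrable (fun x => gauss (y - x)) μ := by
  refine Integrable.mono' (integrable_const (1 : ℝ)) ?_ (ae_of_all _ fun x => ?_)
  · exact (gauss_cont.comp (by fun_prop : Continuous fun x : ℝ => y - x)).aestronglyMeasurable
  · rw [Real.norm_of_nonneg (gauss_pos _).le]; exact gauss_le_one _

lemma prod_int (μ : Measure ℝ) [IsProbabilityMeasure μ] :
    Integrable (fun p : ℝ × ℝ => gauss (p.2 - p.1)) (μ.prod volume) := by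
  have hc : Continuous (fun p : ℝ × ℝ => gauss (p.2 - p.1)) :=
    gauss_cont.comp (by fun_prop : Continuous fun p : ℝ × ℝ => p.2 - p.1)
  rw [integrable_prod_iff hc.aestronglyMeasurable]
  refine ⟨ae_of_all _ fun x => gauss_int.comp_sub_right x, ?_⟩
  have : ∀ x : ℝ, ∫ y, ‖gauss (y - x)‖ = ∫ y, ‖gauss y‖ := fun x =>
    integral_sub_right_eq_self (fun y => ‖gauss y‖) x
  simp only [this]
  exact integrable_const _

lemma outDen_int (μ : Measure ℝ) [IsProbabilityMeasure μ] : Integrable (outDen μ) :=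
  (prod_int μ).integral_prod_right

lemma outDen_integral (μ : Measure ℝ) [IsProbabilityMeasure μ] :
    ∫ y, outDen μ y = ∫ t, gauss t := by
  unfold outDen
  rw [← integral_integral_swap (f := fun x y => gauss (y - x)) (prod_int μ)]
  have : ∀ x : ℝ, ∫ y, gauss (y - x) = ∫ y, gauss y := fun x =>
    integral_sub_right_eq_self (fun y => gauss y) x
  simp [this]

lemma outDen_sq_int (μ : Measure ℝ) [IsProbabilityMeasure μ]
    (hm : ∫⁻ x, ENNReal.ofReal (x ^ 2) ∂μ < ⊤) : Integrable fun y => y ^ 2 * outDen μ y := by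
  have hx : Integrable (fun x : ℝ => x ^ 2) μ := by
    refine ⟨(by fun_prop : Continuous fun x : ℝ => x ^ 2).aestronglyMeasurable, ?_⟩
    rw [hasFiniteIntegral_iff_ofReal (ae_of_all _ fun x => sq_nonneg x)]
    exact hm
  have hc : Continuous (fun p : ℝ × ℝ => gauss (p.2 - p.1)) :=
    gauss_cont.comp (by fun_prop : Continuous fun p : ℝ × ℝ => p.2 - p.1)
  have hF : Integrable (fun p : ℝ × ℝ =>
      2 * ((p.2 - p.1) ^ 2 * gauss (p.2 - p.1)) + 2 * p.1 ^ 2 * gauss (p.2 - p.1))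
      (μ.prod volume) := by
    rw [integrable_prod_iff (by fun_prop : Continuous fun p : ℝ × ℝ =>
      2 * ((p.2 - p.1) ^ 2 * gauss (p.2 - p.1))
        + 2 * p.1 ^ 2 * gauss (p.2 - p.1)).aestronglyMeasurable]
    have hi : ∀ x : ℝ, Integrable fun t => 2 * (t ^ 2 * gauss t) + 2 * x ^ 2 * gauss t :=
      fun x => (gauss_sq_int.const_mul 2).add (gauss_int.const_mul _)
    refine ⟨ae_of_all _ fun x => (hi x).comp_sub_right x, ?_⟩
    have : ∀ x : ℝ, ∫ y, ‖2 * ((y - x) ^ 2 * gauss (y - x)) + 2 * x ^ 2 * gauss (y - x)‖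
        = 2 * (∫ t, t ^ 2 * gauss t) + 2 * x ^ 2 * ∫ t, gauss t := by
      intro x
      rw [integral_sub_right_eq_self
        (fun t => ‖2 * (t ^ 2 * gauss t) + 2 * x ^ 2 * gauss t‖) x]
      have h2 : ∀ t : ℝ, ‖2 * (t ^ 2 * gauss t) + 2 * x ^ 2 * gauss t‖
          = 2 * (t ^ 2 * gauss t) + 2 * x ^ 2 * gauss t := fun t => by
        have := gauss_pos t
        exact Real.norm_of_nonneg (by positivity)
      simp only [h2]
      rw [integral_add (gauss_sq_int.const_mul 2) (gauss_int.const_mul _),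
        integral_const_mul, integral_const_mul]
    simp only [this]
    exact (integrable_const _).add ((hx.const_mul 2).mul_const _)
  have hG : Integrable (fun p : ℝ × ℝ => p.2 ^ 2 * gauss (p.2 - p.1)) (μ.prod volume) := by
    refine hF.mono' (by fun_prop : Continuous fun p : ℝ × ℝ =>
      p.2 ^ 2 * gauss (p.2 - p.1)).aestronglyMeasurable (ae_of_all _ fun p => ?_)
    have := gauss_pos (p.2 - p.1)
    rw [Real.norm_of_nonneg (by positivity)]
    nlinarith [mul_nonneg (sq_nonneg (p.2 - 2 * p.1)) this.le]
  refine hG.integral_prod_right.congr (ae_of_all _ fun y => ?_)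
  simp only [outDen]
  rw [integral_const_mul]

lemma outDen_lower (μ : Measure ℝ) [IsProbabilityMeasure μ] :
    ∃ K : ℝ, 0 < K ∧ ∀ y, Real.exp (-y ^ 2) * K ≤ outDen μ y := by
  have hi : Integrable (fun x : ℝ => Real.exp (-x ^ 2) / Real.sqrt (2 * Real.pi)) μ := by
    refine Integrable.mono' (integrable_const (1 / Real.sqrt (2 * Real.pi)))
      (by fun_prop : Continuous fun x : ℝ =>
        Real.exp (-x ^ 2) / Real.sqrt (2 * Real.pi)).aestronglyMeasurable (ae_of_all _ fun x => ?_)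
    rw [Real.norm_of_nonneg (by positivity)]
    gcongr
    exact Real.exp_le_one_iff.2 (by nlinarith [sq_nonneg x])
  refine ⟨∫ x, Real.exp (-x ^ 2) / Real.sqrt (2 * Real.pi) ∂μ, ?_, fun y => ?_⟩
  · rw [integral_pos_iff_support_of_nonneg (fun x => by positivity) hi]
    have : Function.support (fun x : ℝ => Real.exp (-x ^ 2) / Real.sqrt (2 * Real.pi))
        = Set.univ := by
      ext x
      simp only [Function.mem_support, Set.mem_univ, iff_true]
      positivity
    rw [this]; simp
  · unfold outDen
    rw [← integral_const_mul]
    refine integral_mono (hi.const_mul _) (gauss_shift_int μ y) fun x => ?_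
    simp only [gauss]
    rw [← mul_div_assoc, ← Real.exp_add]
    gcongr
    nlinarith [sq_nonneg (y + x)]

lemma outDen_le_one (μ : Measure ℝ) [IsProbabilityMeasure μ] (y : ℝ) : outDen μ y ≤ 1 := by
  have := integral_mono (gauss_shift_int μ y) (integrable_const (1 : ℝ)) fun x => gauss_le_one _
  simpa [outDen] using this

lemma outDen_pos (μ : Measure ℝ) [IsProbabilityMeasure μ] (y : ℝ) : 0 < outDen μ y := by
  obtain ⟨K, hK, h⟩ := outDen_lower μ
  exact lt_of_lt_of_le (by positivity) (h y)

lemma outDen_mix (μ₀ μ : Measure ℝ) [IsProbabilityMeasure μ₀] [IsProbabilityMeasure μ]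
    {θ : ℝ} (h0 : 0 < θ) (h1 : θ < 1) (y : ℝ) :
    outDen (ENNReal.ofReal (1 - θ) • μ₀ + ENNReal.ofReal θ • μ) y
      = (1 - θ) * outDen μ₀ y + θ * outDen μ y := by
  unfold outDen
  rw [integral_add_measure ((gauss_shift_int μ₀ y).smul_measure ENNReal.ofReal_ne_top)
    ((gauss_shift_int μ y).smul_measure ENNReal.ofReal_ne_top), integral_smul_measure,
    integral_smul_measure, ENNReal.toReal_ofReal (by linarith), ENNReal.toReal_ofReal h0.le]
  simp

lemma pt_lower {a b θ : ℝ} (ha : 0 < a) (hb : 0 < b) (h0 : 0 < θ) (h1 : θ < 1) :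
    b - a ≤ (1 / θ) * (((1 - θ) * a + θ * b) * Real.log (((1 - θ) * a + θ * b) / a)) := by
  set p := (1 - θ) * a + θ * b with hp
  have hpp : 0 < p := by have : 0 < 1 - θ := by linarith
                         positivity
  have h := Real.one_sub_inv_le_log_of_pos (div_pos hpp ha)
  have h2 : p - a ≤ p * Real.log (p / a) := by
    have := mul_le_mul_of_nonneg_left h hpp.le
    have e : p * (1 - (p / a)⁻¹) = p - a := by field_simp
    linarith
  rw [one_div, ← div_eq_inv_mul, le_div_iff₀ h0]
  calc (b - a) * θ = p - a := by rw [hp]; ring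
    _ ≤ _ := h2

lemma pt_upper {a b θ : ℝ} (ha : 0 < a) (hb : 0 < b) (h0 : 0 < θ) (h1 : θ < 1) :
    (1 / θ) * (((1 - θ) * a + θ * b) * Real.log (((1 - θ) * a + θ * b) / a))
      ≤ b * Real.log (b / a) := by
  have h := Real.convexOn_mul_log.2 (show (1 : ℝ) ∈ Set.Ici 0 by simp)
    (show b / a ∈ Set.Ici 0 from (div_pos hb ha).le) (show 0 ≤ 1 - θ by linarith) h0.le (by ring)
  simp only [smul_eq_mul, Real.log_one, mul_zero, mul_one, zero_add] at h
  have e : ((1 - θ) * a + θ * b) / a = 1 - θ + θ * (b / a) := by field_simp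
  rw [e, one_div, ← div_eq_inv_mul, div_le_iff₀ h0]
  have e2 : (1 - θ) * a + θ * b = a * (1 - θ + θ * (b / a)) := by field_simp
  have := mul_le_mul_of_nonneg_left h ha.le
  rw [e2]
  calc _ = a * ((1 - θ + θ * (b / a)) * Real.log (1 - θ + θ * (b / a))) := by ring
    _ ≤ _ := this
    _ = _ := by field_simp

lemma pt_lim {a b : ℝ} (ha : 0 < a) :
    Tendsto (fun θ : ℝ => (1 / θ) *
      (((1 - θ) * a + θ * b) * Real.log (((1 - θ) * a + θ * b) / a)))
      (nhdsWithin 0 (Set.Ioi 0)) (nhds (b - a)) := by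
  have hp : HasDerivAt (fun θ : ℝ => (1 - θ) * a + θ * b) (b - a) 0 := by
    have := (((hasDerivAt_id (0 : ℝ)).const_sub 1).mul_const a).add
      ((hasDerivAt_id (0 : ℝ)).mul_const b)
    convert! this using 1
    ring
  have hl := (hp.div_const a).log (by simp [ha.ne'])
  have h := hp.mul hl
  have h' := h.tendsto_slope_zero
  have h2 := h'.mono_left (nhdsWithin_mono (0 : ℝ) (fun x (hx : x ∈ Set.Ioi 0) => (ne_of_gt hx : x ≠ 0)))
  convert! h2 using 1
  · ext θ
    simp [ha.ne']
  · congr 1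
    simp [ha.ne']
    field_simp

/-- for probability measures `μ₀, μ` with finite second moments and
`μ_θ = (1−θ)μ₀ + θμ`, the Kullback–Leibler divergence between the output densities
`p_Y(·;μ_θ)` and `p_Y(·;μ₀)` is `o(θ)` as `θ → 0⁺`:
`lim_{θ→0⁺} (1/θ) ∫ p_Y(y;μ_θ) log(p_Y(y;μ_θ)/p_Y(y;μ₀)) dy = 0`. -/
theorem outDen_klDiv_littleO (μ₀ μ : Measure ℝ)
    [IsProbabilityMeasure μ₀] [IsProbabilityMeasure μ]
    (hm0 : ∫⁻ x, ENNReal.ofReal (x ^ 2) ∂μ₀ < ⊤) (hm : ∫⁻ x, ENNReal.ofReal (x ^ 2) ∂μ < ⊤) :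
    Tendsto
      (fun θ : ℝ => (1 / θ) *
        ∫ y : ℝ,
          outDen (ENNReal.ofReal (1 - θ) • μ₀ + ENNReal.ofReal θ • μ) y *
            Real.log (outDen (ENNReal.ofReal (1 - θ) • μ₀ + ENNReal.ofReal θ • μ) y / outDen μ₀ y))
      (nhdsWithin 0 (Set.Ioi 0)) (nhds 0) := by
  have hae := fun y => outDen_pos μ₀ y
  have hbe := fun y => outDen_pos μ y
  obtain ⟨K, hK, hlow⟩ := outDen_lower μ₀
  have key : Tendsto (fun θ : ℝ => ∫ y : ℝ, (1 / θ) *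
      (((1 - θ) * outDen μ₀ y + θ * outDen μ y) *
        Real.log (((1 - θ) * outDen μ₀ y + θ * outDen μ y) / outDen μ₀ y)))
      (nhdsWithin 0 (Set.Ioi 0)) (nhds (∫ y, (outDen μ y - outDen μ₀ y))) := by
    have hev : ∀ᶠ θ : ℝ in nhdsWithin 0 (Set.Ioi 0), 0 < θ ∧ θ < 1 :=
      Ioo_mem_nhdsGT one_pos
    refine tendsto_integral_filter_of_dominated_convergence
      (fun y => outDen μ₀ y + outDen μ y + (y ^ 2 * outDen μ y + |Real.log K| * outDen μ y))
      ?_ ?_ ?_ ?_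
    · refine Eventually.of_forall fun θ => ?_
      have m0 := (outDen_int μ₀).aestronglyMeasurable.aemeasurable
      have m1 := (outDen_int μ).aestronglyMeasurable.aemeasurable
      have mp := (m0.const_mul (1 - θ)).add (m1.const_mul θ)
      exact ((mp.mul (Real.measurable_log.comp_aemeasurable (mp.div m0))).const_mul
        (1 / θ)).aestronglyMeasurable
    · filter_upwards [hev] with θ hθ
      refine ae_of_all _ fun y => ?_
      have ha := hae y
      have hb := hbe y
      have hl := pt_lower ha hb hθ.1 hθ.2
      have hu := pt_upper ha hb hθ.1 hθ.2
      have hlog : Real.log (outDen μ y / outDen μ₀ y) ≤ y ^ 2 + |Real.log K| := by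
        rw [Real.log_div hb.ne' ha.ne']
        have h1 := Real.log_nonpos hb.le (outDen_le_one μ y)
        have h2 := Real.log_le_log (by positivity) (hlow y)
        rw [Real.log_mul (Real.exp_pos _).ne' hK.ne', Real.log_exp] at h2
        have := neg_abs_le (Real.log K)
        linarith
      have h3 := mul_le_mul_of_nonneg_left hlog hb.le
      have h4 : 0 ≤ y ^ 2 * outDen μ y + |Real.log K| * outDen μ y := by positivity
      rw [Real.norm_eq_abs, abs_le]
      constructor <;> linarith
    · exact ((outDen_int μ₀).add (outDen_int μ)).add
        ((outDen_sq_int μ hm).add ((outDen_int μ).const_mul _))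
    · exact ae_of_all _ fun y => pt_lim (hae y)
  rw [integral_sub (outDen_int μ) (outDen_int μ₀), outDen_integral, outDen_integral,
    sub_self] at key
  refine key.congr' ?_
  filter_upwards [Ioo_mem_nhdsGT (one_pos : (0 : ℝ) < 1)] with θ hθ
  rw [integral_const_mul]
  simp only [outDen_mix μ₀ μ hθ.1 hθ.2]
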